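/- Let z ∈ Z(A,K) and let Y be the unique sign vector such that π(z) ∈ F_Y. Then the sub-poset Sal(A,K)_z := {(X,T) ∈ Sal(A,K) : z ∈ U_{X,T}} equals {(X, X∘Y) : X ∈ L(A, K_z)}, and the map X ↦ (X, X∘Y) is an isomorphism of posets from L(A, K_z) (ordered by ≤) onto Sal(A,K)_z (with the order induced from Sal(A,K)). -/

import Mathlib

/-- Composition of sign vectors: `(X ∘ Y) e = X e` if `X e ≠ 0`, and `Y e` otherwise. -/
def scomp {E : Type*} (X Y : E → SignType) : E → SignType :=
  fun e => if X e = 0 then Y e else X e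

/-- The partial order on sign vectors: `X ≤ Y` iff `X ∘ Y = Y`. -/
def sle {E : Type*} (X Y : E → SignType) : Prop := scomp X Y = Y

theorem sle_refl {E : Type*} (X : E → SignType) : sle X X := by
  funext e; show (if X e = 0 then X e else X e) = X e; split <;> rfl

theorem sle_trans {E : Type*} {X Y Z : E → SignType} (h₁ : sle X Y) (h₂ : sle Y Z) :
    sle X Z := by
  funext e
  have h1 := congrFun h₁ e
  have h2 := congrFun h₂ e
  revert h1 h2
  show (if X e = 0 then Y e else X e) = Y e → (if Y e = 0 then Z e else Y e) = Z e →
    (if X e = 0 then Z e else X e) = Z e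
  generalize X e = a; generalize Y e = b; generalize Z e = c
  revert a b c; decide

theorem sle_antisymm {E : Type*} {X Y : E → SignType} (h₁ : sle X Y) (h₂ : sle Y X) :
    X = Y := by
  funext e
  have h1 := congrFun h₁ e
  have h2 := congrFun h₂ e
  revert h1 h2
  show (if X e = 0 then Y e else X e) = Y e → (if Y e = 0 then X e else Y e) = X e → X e = Y e
  generalize X e = a; generalize Y e = b
  revert a b; decide

/-- The separating set of two sign vectors: the indices where they take opposite
nonzero signs. -/
def SepSet {E : Type*} (X Y : E → SignType) : Set E :=
  {e | (X e = 1 ∧ Y e = -1) ∨ (X e = -1 ∧ Y e = 1)}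

/-- A covector of `L`, i.e. an element of `L` regarded as a member of the poset of
covectors. -/
@[ext]
structure Cov {E : Type*} (L : Set (E → SignType)) where
  val : E → SignType
  mem : val ∈ L

/-- The poset of covectors, ordered by `X ≤ Y` iff `X ∘ Y = Y`. -/
instance {E : Type*} (L : Set (E → SignType)) : PartialOrder (Cov L) where
  le X Y := sle X.val Y.val
  le_refl X := sle_refl X.val
  le_trans _ _ _ h₁ h₂ := sle_trans h₁ h₂
  le_antisymm _ _ h₁ h₂ := Cov.ext (sle_antisymm h₁ h₂)

section Geometry

variable {E : Type*} {V : Type*} [NormedAddCommGroup V] [NormedSpace ℝ V]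

/-- The face of a sign vector `X`, relative to the family of cooriented affine hyperplanes
`H_e = {v | f e v = 0}`, with positive side `H_e⁺ = {v | f e v > 0}` and negative side
`H_e⁻ = {v | f e v < 0}`. -/
def face (f : E → (V →ᵃ[ℝ] ℝ)) (X : E → SignType) : Set V :=
  {v | ∀ e, SignType.sign (f e v) = X e}

/-- The conditional oriented matroid `L(A,K)`: the set of sign vectors whose face
meets `K`. -/
def covs (f : E → (V →ᵃ[ℝ] ℝ)) (K : Set V) : Set (E → SignType) :=
  {X | (face f X ∩ K).Nonempty}

/-- A tope of `L(A,K)`: a maximal covector. -/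
def IsTope (f : E → (V →ᵃ[ℝ] ℝ)) (K : Set V) (T : E → SignType) : Prop :=
  T ∈ covs f K ∧ ∀ Y ∈ covs f K, sle T Y → Y = T

/-- The set of topes of `L(A,K)`, as a type carrying the discrete topology. -/
def Topes (f : E → (V →ᵃ[ℝ] ℝ)) (K : Set V) : Type _ := {T : E → SignType // IsTope f K T}

instance (f : E → (V →ᵃ[ℝ] ℝ)) (K : Set V) : TopologicalSpace (Topes f K) := ⊥

instance (f : E → (V →ᵃ[ℝ] ℝ)) (K : Set V) : DiscreteTopology (Topes f K) := ⟨rfl⟩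

/-- Points of `K × T(A,K)`. -/
abbrev ZPre (f : E → (V →ᵃ[ℝ] ℝ)) (K : Set V) : Type _ := K × Topes f K

/-- The gluing relation defining `Z(A,K)`: `(v,T) ∼ (v',T')` iff `v = v'` and `v` lies on
no hyperplane separating `T` from `T'`. -/
def ZRel (f : E → (V →ᵃ[ℝ] ℝ)) (K : Set V) : ZPre f K → ZPre f K → Prop :=
  fun p q => (p.1 : V) = (q.1 : V) ∧ ∀ e ∈ SepSet p.2.1 q.2.1, f e (p.1 : V) ≠ 0

/-- The space `Z(A,K)`: one copy of `K` for each tope, glued along the complement of the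
separating hyperplanes, with the quotient topology. -/
def ZSpace (f : E → (V →ᵃ[ℝ] ℝ)) (K : Set V) : Type _ := Quot (ZRel f K)

instance (f : E → (V →ᵃ[ℝ] ℝ)) (K : Set V) : TopologicalSpace (ZSpace f K) :=
  inferInstanceAs (TopologicalSpace (Quot (ZRel f K)))

/-- The projection `π : Z(A,K) → V` (with image `K`), sending `[(v,T)]` to `v`. -/
def Zproj (f : E → (V →ᵃ[ℝ] ℝ)) (K : Set V) : ZSpace f K → V :=
  Quot.lift (fun p => (p.1 : V)) (fun _ _ h => h.1)

/-- The set `K_{X,T} = K ∩ ⋂_{e : X_e = 0} H_e^{T_e}`. -/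
def KXT (f : E → (V →ᵃ[ℝ] ℝ)) (K : Set V) (X T : E → SignType) : Set V :=
  K ∩ ⋂ e ∈ {e | X e = 0}, {v | SignType.sign (f e v) = T e}

/-- The subset `U_{X,T} ⊆ Z(A,K)`: the image of `K_{X,T} × {T}` under the quotient map. -/
def UXT (f : E → (V →ᵃ[ℝ] ℝ)) (K : Set V) (X : E → SignType) (T : Topes f K) :
    Set (ZSpace f K) :=
  {z | ∃ (v : V) (hv : v ∈ K), v ∈ KXT f K X T.1 ∧ z = Quot.mk (ZRel f K) (⟨v, hv⟩, T)}

/-- The complexified complement `M(A,K)`, where `V ⊗ ℂ` is modeled as `V × V` (real and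
imaginary parts): `v + iw` lies on `H_e ⊗ ℂ` iff `f e v = 0` and the linear part of `f e`
vanishes on `w`. -/
def MSpace (f : E → (V →ᵃ[ℝ] ℝ)) (K : Set V) : Type _ :=
  {p : V × V // p.1 ∈ K ∧ ∀ e, ¬(f e p.1 = 0 ∧ (f e).linear p.2 = 0)}

instance (f : E → (V →ᵃ[ℝ] ℝ)) (K : Set V) : TopologicalSpace (MSpace f K) :=
  inferInstanceAs (TopologicalSpace {p : V × V // p.1 ∈ K ∧ _})

/-- The projection `ρ : M(A,K) → V` (with image `K`), sending `v + iw` to `v`. -/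
def Mproj (f : E → (V →ᵃ[ℝ] ℝ)) (K : Set V) : MSpace f K → V := fun p => p.1.1

end Geometry

/-- The Salvetti poset `Sal(A,K)`: pairs `(X,T)` where `T` is a tope of `L(A,K)` and
`X ≤ T`. -/
@[ext]
structure SalP {E : Type*} {V : Type*} [NormedAddCommGroup V] [NormedSpace ℝ V]
    (f : E → (V →ᵃ[ℝ] ℝ)) (K : Set V) where
  X : E → SignType
  T : E → SignType
  memX : X ∈ covs f K
  topeT : IsTope f K T
  leXT : sle X T

/-- The partial order on the Salvetti poset: `(X,T) ⪯ (X',T')` iff `X ≤ X'` and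
`X' ∘ T = T'`. -/
instance {E : Type*} {V : Type*} [NormedAddCommGroup V] [NormedSpace ℝ V]
    (f : E → (V →ᵃ[ℝ] ℝ)) (K : Set V) : PartialOrder (SalP f K) where
  le p q := sle p.X q.X ∧ scomp q.X p.T = q.T
  le_refl p := ⟨sle_refl p.X, p.leXT⟩
  le_trans p q r h₁ h₂ := by
    refine ⟨sle_trans h₁.1 h₂.1, ?_⟩
    funext e
    have hc1 := congrFun h₁.2 e
    have hc2 := congrFun h₂.2 e
    have hc3 := congrFun h₂.1 e
    revert hc1 hc2 hc3
    show (if q.X e = 0 then p.T e else q.X e) = q.T e →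
      (if r.X e = 0 then q.T e else r.X e) = r.T e →
      (if q.X e = 0 then r.X e else q.X e) = r.X e →
      (if r.X e = 0 then p.T e else r.X e) = r.T e
    generalize q.X e = a; generalize p.T e = b; generalize q.T e = c
    generalize r.X e = d; generalize r.T e = g
    revert a b c d g; decide
  le_antisymm p q h₁ h₂ := by
    have hX : p.X = q.X := sle_antisymm h₁.1 h₂.1
    have hT : q.T = p.T := by rw [← h₁.2, hX.symm]; exact p.leXT
    ext1 <;> simp [hX, hT.symm]

theorem sle_scomp {E : Type*} (X Y : E → SignType) : sle X (scomp X Y) := by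
  funext e
  by_cases h : X e = 0 <;> simp [scomp, h]

theorem scomp_scomp_of_sle {E : Type*} {X X' : E → SignType} (h : sle X X')
    (Y : E → SignType) : scomp X' (scomp X Y) = scomp X' Y := by
  funext e
  have he := congrFun h e
  by_cases h0 : X e = 0
  · simp [scomp, h0]
  · by_cases h1 : X' e = 0
    · simp [scomp, h0, h1] at he
    · simp [scomp, h1]

section

variable {E : Type*} {V : Type*} [NormedAddCommGroup V] [NormedSpace ℝ V]

theorem mem_KXT {f : E → (V →ᵃ[ℝ] ℝ)} {K : Set V} {X T : E → SignType} {v : V} :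
    v ∈ KXT f K X T ↔ v ∈ K ∧ ∀ e, X e = 0 → SignType.sign (f e v) = T e := by
  simp [KXT]

theorem isTope_of_forall_ne_zero {f : E → (V →ᵃ[ℝ] ℝ)} {K : Set V} {T : E → SignType}
    (hT : T ∈ covs f K) (h0 : ∀ e, T e ≠ 0) : IsTope f K T := by
  refine ⟨hT, fun Y _ hle => ?_⟩
  rw [← hle]
  funext e
  simp [scomp, h0 e]

theorem eventually_sign_eq_of_ne_zero [FiniteDimensional ℝ V] (g : V →ᵃ[ℝ] ℝ) {w : V}
    (hw : g w ≠ 0) :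
    ∀ᶠ u in nhds w, SignType.sign (g u) = SignType.sign (g w) := by
  have hc : ContinuousAt (fun u => SignType.sign (g u)) w :=
    ContinuousAt.comp (f := g) (continuousAt_sign_of_ne_zero hw)
      g.continuous_of_finiteDimensional.continuousAt
  exact hc.eventually (p := fun s => s = SignType.sign (g w))
    ((isOpen_discrete _).mem_nhds rfl)

theorem dense_setOf_ne_zero [FiniteDimensional ℝ V] {g : V →ᵃ[ℝ] ℝ} (hg : g.linear ≠ 0) :
    Dense {u | g u ≠ 0} := by
  have hopen : IsOpenMap g := AffineMap.isOpenMap_linear_iff.mp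
    (g.linear.isOpenMap_of_finiteDimensional (LinearMap.surjective hg))
  exact (dense_compl_singleton (0 : ℝ)).preimage hopen

theorem IsTope.ne_zero [FiniteDimensional ℝ V] [Finite E] {f : E → (V →ᵃ[ℝ] ℝ)}
    (hf : ∀ e, (f e).linear ≠ 0) {K : Set V} (hK : IsOpen K) {T : E → SignType}
    (hT : IsTope f K T) (e : E) : T e ≠ 0 := by
  obtain ⟨⟨w, hwT, hwK⟩, hmax⟩ := hT
  have hdense : Dense (⋂ e, {u | f e u ≠ 0}) := by
    have : CompleteSpace V := FiniteDimensional.complete ℝ V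
    exact dense_iInter_of_isOpen
      (fun e => isOpen_ne.preimage (f e).continuous_of_finiteDimensional)
      (fun e => dense_setOf_ne_zero (hf e))
  have hev : ∀ᶠ u in nhds w, u ∈ K ∧
      ∀ e, f e w ≠ 0 → SignType.sign (f e u) = SignType.sign (f e w) := by
    refine Filter.Eventually.and (hK.mem_nhds hwK) (Filter.eventually_all.mpr fun e => ?_)
    by_cases h : f e w = 0
    · simp [h]
    · simpa [h] using eventually_sign_eq_of_ne_zero (f e) h
  obtain ⟨u, hu, huK, hus⟩ :=
    ((mem_closure_iff_frequently.mp (hdense w)).and_eventually hev).exists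
  have hu' : (fun e => SignType.sign (f e u)) = T := by
    refine hmax _ ⟨u, fun _ => rfl, huK⟩ (funext fun e => ?_)
    by_cases h : T e = 0
    · simp [scomp, h]
    · have hw : f e w ≠ 0 := fun h0 => h (by rw [← hwT e, h0, sign_zero])
      simp [scomp, h, hus e hw, hwT e]
  rw [← hu']
  exact sign_ne_zero.mpr (Set.mem_iInter.mp hu e)

theorem scomp_mem_covs [FiniteDimensional ℝ V] [Finite E] {f : E → (V →ᵃ[ℝ] ℝ)} {K : Set V}
    (hK : Convex ℝ K) {X Y : E → SignType} (hX : X ∈ covs f K) (hY : Y ∈ covs f K) :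
    scomp X Y ∈ covs f K := by
  obtain ⟨x, hx, hxK⟩ := hX
  obtain ⟨y, hy, hyK⟩ := hY
  have hlim : Filter.Tendsto (AffineMap.lineMap x y : ℝ → V) (nhdsWithin 0 (Set.Ioi 0))
      (nhds x) := by
    have h := (AffineMap.lineMap_continuous (R := ℝ) (p := x) (q := y)).tendsto 0
    rw [AffineMap.lineMap_apply_zero] at h
    exact h.mono_left nhdsWithin_le_nhds
  have hev : ∀ᶠ t in nhdsWithin (0 : ℝ) (Set.Ioi 0), t ∈ Set.Ioo (0 : ℝ) 1 ∧
      ∀ e, SignType.sign (f e (AffineMap.lineMap x y t)) = scomp X Y e := by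
    refine Filter.Eventually.and (Ioo_mem_nhdsGT one_pos) (Filter.eventually_all.mpr fun e => ?_)
    by_cases h : f e x = 0
    · have hXe : X e = 0 := by rw [← hx e, h, sign_zero]
      filter_upwards [self_mem_nhdsWithin] with t ht
      rw [AffineMap.apply_lineMap, h, AffineMap.lineMap_apply]
      simp [scomp, hXe, sign_mul, sign_pos (Set.mem_Ioi.mp ht), hy e]
    · have hXe : X e ≠ 0 := by rw [← hx e]; exact sign_ne_zero.mpr h
      filter_upwards [hlim.eventually (eventually_sign_eq_of_ne_zero (f e) h)] with t ht
      rw [ht, hx e, scomp, if_neg hXe]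
  obtain ⟨t, ht, hs⟩ := hev.exists
  exact ⟨_, hs, hK.lineMap_mem hxK hyK ⟨ht.1.le, ht.2.le⟩⟩

theorem mem_covs_KXT {f : E → (V →ᵃ[ℝ] ℝ)} {K : Set V} {X Y S : E → SignType} :
    X ∈ covs f (KXT f K Y S) ↔ X ∈ covs f K ∧ ∀ e, Y e = 0 → X e = S e := by
  constructor
  · rintro ⟨x, hx, hxK⟩
    rw [mem_KXT] at hxK
    exact ⟨⟨x, hx, hxK.1⟩, fun e he => (hx e).symm.trans (hxK.2 e he)⟩
  · rintro ⟨⟨x, hx, hxK⟩, h⟩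
    exact ⟨x, hx, mem_KXT.mpr ⟨hxK, fun e he => (hx e).trans (h e he)⟩⟩

theorem ZRel_iff_of_ne_zero {f : E → (V →ᵃ[ℝ] ℝ)} {K : Set V}
    (h0 : ∀ (T : Topes f K) e, T.1 e ≠ 0) {p q : ZPre f K} :
    ZRel f K p q ↔
      (p.1 : V) = q.1 ∧ ∀ e, f e (p.1 : V) = 0 → p.2.1 e = q.2.1 e := by
  have key : ∀ a b : SignType, a ≠ 0 → b ≠ 0 →
      (¬((a = 1 ∧ b = -1) ∨ (a = -1 ∧ b = 1)) ↔ a = b) := by decide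
  refine and_congr_right fun _ => forall_congr' fun e => ?_
  rw [← key _ _ (h0 p.2 e) (h0 q.2 e)]
  exact imp_not_comm

theorem ZSpace_mk_eq_iff_of_ne_zero {f : E → (V →ᵃ[ℝ] ℝ)} {K : Set V}
    (h0 : ∀ (T : Topes f K) e, T.1 e ≠ 0) {p q : ZPre f K} :
    Quot.mk (ZRel f K) p = Quot.mk (ZRel f K) q ↔
      (p.1 : V) = q.1 ∧ ∀ e, f e (p.1 : V) = 0 → p.2.1 e = q.2.1 e := by
  rw [← ZRel_iff_of_ne_zero h0]
  refine Equivalence.quot_mk_eq_iff ⟨fun p => ?_, fun {p q} h => ?_, fun {p q r} h₁ h₂ => ?_⟩ p q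
  · exact (ZRel_iff_of_ne_zero h0).mpr ⟨rfl, fun _ _ => rfl⟩
  · rw [ZRel_iff_of_ne_zero h0] at h ⊢
    exact ⟨h.1.symm, fun e he => (h.2 e (h.1 ▸ he)).symm⟩
  · rw [ZRel_iff_of_ne_zero h0] at h₁ h₂ ⊢
    exact ⟨h₁.1.trans h₂.1, fun e he => (h₁.2 e he).trans (h₂.2 e (h₁.1 ▸ he))⟩

theorem mk_mem_UXT_iff_of_ne_zero {f : E → (V →ᵃ[ℝ] ℝ)} {K : Set V}
    (h0 : ∀ (T : Topes f K) e, T.1 e ≠ 0) {v : V} (hvK : v ∈ K) (S : Topes f K)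
    {Y : E → SignType} (hvY : v ∈ face f Y) {X : E → SignType} {T : Topes f K} :
    Quot.mk (ZRel f K) (⟨v, hvK⟩, S) ∈ UXT f K X T ↔
      (∀ e, X e = 0 → Y e = T.1 e) ∧ ∀ e, Y e = 0 → S.1 e = T.1 e := by
  have hY0 : ∀ e, f e v = 0 ↔ Y e = 0 := fun e => by rw [← hvY e, sign_eq_zero_iff]
  constructor
  · rintro ⟨w, hw, hwX, heq⟩
    obtain ⟨hvw, hS⟩ := (ZSpace_mk_eq_iff_of_ne_zero h0).mp heq
    obtain rfl : v = w := hvw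
    exact ⟨fun e he => (hvY e).symm.trans ((mem_KXT.mp hwX).2 e he),
      fun e he => hS e ((hY0 e).mpr he)⟩
  · rintro ⟨hX, hS⟩
    exact ⟨v, hvK, mem_KXT.mpr ⟨hvK, fun e he => (hvY e).trans (hX e he)⟩,
      (ZSpace_mk_eq_iff_of_ne_zero h0).mpr ⟨rfl, fun e he => hS e ((hY0 e).mp he)⟩⟩

end

variable {V : Type*} [NormedAddCommGroup V] [NormedSpace ℝ V] [FiniteDimensional ℝ V]
variable {E : Type*} [Fintype E]

/-- Let `z ∈ Z(A,K)` be represented by `(v,S)`, and let `Y` be the (unique) sign vector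
with `π(z) = v ∈ F_Y`.  Then the sub-poset `Sal(A,K)_z = {(X,T) | z ∈ U_{X,T}}` equals
`{(X, X∘Y) | X ∈ L(A, K_z)}` (where `K_z = K_{Y,S}`), and `X ↦ (X, X∘Y)` is an
isomorphism of posets from `L(A, K_z)` onto `Sal(A,K)_z`. -/
theorem subposet_iso_covs
    (f : E → (V →ᵃ[ℝ] ℝ)) (hf : ∀ e, (f e).linear ≠ 0)
    (K : Set V) (hKne : K.Nonempty) (hKconv : Convex ℝ K) (hKopen : IsOpen K)
    (v : V) (hvK : v ∈ K) (S : Topes f K)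
    (Y : E → SignType) (hvY : v ∈ face f Y) :
    (∀ p : SalP f K,
      Quot.mk (ZRel f K) (⟨v, hvK⟩, S) ∈ UXT f K p.X ⟨p.T, p.topeT⟩ ↔
        (p.X ∈ covs f (KXT f K Y S.1) ∧ p.T = scomp p.X Y)) ∧
    ∃ iso : Cov (covs f (KXT f K Y S.1)) ≃o
        {p : SalP f K // Quot.mk (ZRel f K) (⟨v, hvK⟩, S) ∈ UXT f K p.X ⟨p.T, p.topeT⟩},
      ∀ X : Cov (covs f (KXT f K Y S.1)),
        (iso X).1.X = X.val ∧ (iso X).1.T = scomp X.val Y := by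
  have h0 : ∀ (T : Topes f K) e, T.1 e ≠ 0 := fun T e => T.2.ne_zero hf hKopen e
  have hmem : ∀ p : SalP f K,
      Quot.mk (ZRel f K) (⟨v, hvK⟩, S) ∈ UXT f K p.X ⟨p.T, p.topeT⟩ ↔
        (p.X ∈ covs f (KXT f K Y S.1) ∧ p.T = scomp p.X Y) := by
    intro p
    refine (mk_mem_UXT_iff_of_ne_zero h0 hvK S hvY).trans ?_
    rw [mem_covs_KXT]
    have hle : ∀ e, p.X e ≠ 0 → p.X e = p.T e := fun e he => by
      simpa [scomp, he] using congrFun p.leXT e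
    constructor
    · rintro ⟨hX, hS⟩
      refine ⟨⟨p.memX, fun e he => ?_⟩, funext fun e => ?_⟩
      · rw [hS e he]
        exact hle e fun hXe => p.topeT.ne_zero hf hKopen e ((hX e hXe).symm.trans he)
      · by_cases he : p.X e = 0
        · simpa [scomp, he] using (hX e he).symm
        · simpa [scomp, he] using (hle e he).symm
    · rintro ⟨⟨-, hS⟩, hT⟩
      refine ⟨fun e he => by simp [hT, scomp, he], fun e he => ?_⟩
      rw [← hS e he]
      exact hle e (hS e he ▸ h0 S e)
  refine ⟨hmem, ?_⟩
  have htope : ∀ X ∈ covs f (KXT f K Y S.1), IsTope f K (scomp X Y) := by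
    intro X hX
    obtain ⟨hXK, hXS⟩ := mem_covs_KXT.mp hX
    refine isTope_of_forall_ne_zero (scomp_mem_covs hKconv hXK ⟨v, hvY, hvK⟩) fun e he => ?_
    by_cases h : X e = 0
    · simp only [scomp, h, if_true] at he
      exact h0 S e ((hXS e he).symm.trans h)
    · simp [scomp, h] at he
  refine ⟨{
    toFun := fun X => ⟨⟨X.val, scomp X.val Y, (mem_covs_KXT.mp X.mem).1, htope _ X.mem,
      sle_scomp _ _⟩, (hmem _).mpr ⟨X.mem, rfl⟩⟩
    invFun := fun p => ⟨p.1.X, ((hmem p.1).mp p.2).1⟩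
    left_inv := fun _ => rfl
    right_inv := fun p => Subtype.ext (SalP.ext rfl ((hmem p.1).mp p.2).2.symm)
    map_rel_iff' := ⟨fun h => h.1, fun h => ⟨h, scomp_scomp_of_sle h Y⟩⟩ },
    fun _ => ⟨rfl, rfl⟩⟩
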